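/- arXiv:1209.2246 — 8 statements merged into one kernel-verified Lean document; each statement's English description precedes it below -/
import Mathlib

section
/- Let γ, σ : S¹ → ℝ be measurable with γ ≥ 0, and let s ∈ ℝ be such that γ + sσ ≥ 0. Then ‖F(γ + sσ) − F(γ)‖²_{L²(S¹×[0,∞))} = |s| · ∫_{S¹} |σ(t)| dμ(t). -/
open MeasureTheory Real Set Filter Topology

noncomputable section

instance : Fact (0 < 2 * π) := ⟨by positivity⟩

/-- The circle `ℝ / 2πℤ`. -/
abbrev S1 : Type := AddCircle (2 * π)

/-- The Haar measure of total mass `2π` on the circle. -/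
abbrev μ : Measure S1 := volume

/-- The product of `μ` with Lebesgue measure restricted to `[0, ∞)`,
modelling the measure on `S¹ × [0, ∞)`. -/
abbrev ν : Measure (S1 × ℝ) := μ.prod (volume.restrict (Ici (0:ℝ)))

/-- The characteristic function of the hypograph of `γ`:
`F γ (t, x) = 1` if `x ≤ γ t` and `0` otherwise. -/
def F (γ : S1 → ℝ) : S1 × ℝ → ℝ := fun p => if p.2 ≤ γ p.1 then 1 else 0

/-- `‖F(γ + sσ) - F(γ)‖²_{L²} = |s| · ∫ |σ|`. -/
theorem eLpNorm_sq_F_add_smul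
    (γ σ : S1 → ℝ) (hγ : Measurable γ) (hσ : Measurable σ) (s : ℝ)
    (hγ0 : ∀ t, 0 ≤ γ t) (hγσ0 : ∀ t, 0 ≤ γ t + s * σ t) :
    eLpNorm (fun p => F (fun t => γ t + s * σ t) p - F γ p) 2 ν ^ 2
      = ENNReal.ofReal |s| * ∫⁻ t, ENNReal.ofReal |σ t| ∂μ := by
  have hF : ∀ g : S1 → ℝ, Measurable g → Measurable (F g) := by
    intro g hg
    unfold F
    exact Measurable.ite (measurableSet_le measurable_snd (hg.comp measurable_fst))
      measurable_const measurable_const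
  have hg' : Measurable (fun t => γ t + s * σ t) := hγ.add (hσ.const_mul s)
  have hm := (hF _ hg').sub (hF _ hγ)
  have h1 : eLpNorm (fun p => F (fun t => γ t + s * σ t) p - F γ p) 2 ν ^ 2
      = ∫⁻ p, ‖F (fun t => γ t + s * σ t) p - F γ p‖ₑ ^ 2 ∂ν := by
    have := eLpNorm_nnreal_pow_eq_lintegral (p := 2) (μ := ν)
      (f := fun p => F (fun t => γ t + s * σ t) p - F γ p) (by norm_num)
    simpa using this
  rw [h1, lintegral_prod _ (by exact ((hm.enorm).pow_const 2).aemeasurable),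
    ← lintegral_const_mul _ (by fun_prop)]
  refine lintegral_congr fun t => ?_
  have h2 : ∀ x : ℝ, ‖F (fun t => γ t + s * σ t) (t, x) - F γ (t, x)‖ₑ ^ 2
      = (Ioc (min (γ t) (γ t + s * σ t)) (max (γ t) (γ t + s * σ t))).indicator 1 x := by
    intro x
    by_cases ha : x ≤ γ t + s * σ t <;> by_cases hb : x ≤ γ t <;>
      simp [F, ha, hb, indicator, not_lt.2, not_le.1]
  simp_rw [h2]
  rw [lintegral_indicator_one measurableSet_Ioc, Measure.restrict_apply measurableSet_Ioc,
    inter_eq_left.2, Real.volume_Ioc, max_sub_min_eq_abs, ← ENNReal.ofReal_mul (abs_nonneg _),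
    ← abs_mul]
  · congr 2; ring
  · intro x hx
    exact (le_min (hγ0 t) (hγσ0 t)).trans hx.1.le
end
end

section
/- F is nowhere directionally differentiable in the interior of its domain: if γ : S¹ → ℝ is continuous with γ(t) > 0 for every t, and σ : S¹ → ℝ is continuous with σ ≠ 0, then (1/s)·‖F(γ + sσ) − F(γ)‖_{L²(S¹×[0,∞))} tends to +∞ as s → 0⁺. -/
open MeasureTheory Real Set Filter Topology

noncomputable section

/-- `F` is nowhere directionally differentiable: for `γ > 0` continuous and `σ ≠ 0` continuous,
`(1/s) · ‖F(γ + sσ) - F(γ)‖_{L²}` tends to `+∞` as `s → 0⁺`. -/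
theorem F_nowhere_directionally_differentiable
    (γ σ : S1 → ℝ) (hγ : Continuous γ) (hσ : Continuous σ)
    (hγ0 : ∀ t, 0 < γ t) (hσne : σ ≠ 0) :
    Tendsto
      (fun s : ℝ =>
        (1 / s) * (eLpNorm (fun p => F (fun t => γ t + s * σ t) p - F γ p) 2 ν).toReal)
      (𝓝[>] 0) atTop := by
  classical
  have hcσ : Continuous fun t => |σ t| := hσ.abs
  obtain ⟨t₀, ht₀⟩ : ∃ t, σ t ≠ 0 := by
    by_contra h
    push Not at h
    exact hσne (funext h)
  have hint : Integrable (fun t => |σ t|) μ :=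
    hcσ.integrable_of_hasCompactSupport (HasCompactSupport.of_compactSpace _)
  have hk : 0 < ∫ t, |σ t| ∂μ :=
    hcσ.integral_pos_of_hasCompactSupport_nonneg_nonzero
      (HasCompactSupport.of_compactSpace _) (fun t => abs_nonneg _) (x := t₀) (by simpa using ht₀)
  set k := ∫ t, |σ t| ∂μ with hkdef
  -- uniform bounds
  obtain ⟨a, -, ha⟩ := isCompact_univ.exists_isMinOn (univ_nonempty (α := S1)) hγ.continuousOn
  obtain ⟨b, -, hb⟩ := isCompact_univ.exists_isMaxOn (univ_nonempty (α := S1)) hcσ.continuousOn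
  have hδ : 0 < γ a / (|σ b| + 1) := div_pos (hγ0 a) (by positivity)
  have key : ∀ s ∈ Ioo (0:ℝ) (γ a / (|σ b| + 1)),
      (1 / s) * (eLpNorm (fun p => F (fun t => γ t + s * σ t) p - F γ p) 2 ν).toReal
        = √k * (√s)⁻¹ := by
    rintro s ⟨hs, hs2⟩
    have hpos : ∀ t, 0 ≤ γ t + s * σ t := by
      intro t
      have h1 : γ a ≤ γ t := ha (mem_univ t)
      have h2 : |σ t| ≤ |σ b| := hb (mem_univ t)
      rw [lt_div_iff₀ (by positivity)] at hs2
      have h3 := neg_abs_le (σ t)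
      nlinarith
    let A : Set (S1 × ℝ) := {p | p.2 ∈ uIoc (γ p.1) (γ p.1 + s * σ p.1)}
    have hA : MeasurableSet A := by
      have : A = {p : S1 × ℝ | min (γ p.1) (γ p.1 + s * σ p.1) < p.2} ∩
          {p : S1 × ℝ | p.2 ≤ max (γ p.1) (γ p.1 + s * σ p.1)} := rfl
      rw [this]
      exact (measurableSet_lt (by fun_prop) (by fun_prop)).inter
        (measurableSet_le (by fun_prop) (by fun_prop))
    have hνA : ν A = ENNReal.ofReal (s * k) := by
      rw [Measure.prod_apply hA]
      have : ∀ t, (volume.restrict (Ici (0:ℝ))) (Prod.mk t ⁻¹' A) = ENNReal.ofReal (s * |σ t|) := by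
        intro t
        have h1 : Prod.mk t ⁻¹' A = uIoc (γ t) (γ t + s * σ t) := rfl
        have h2 : uIoc (γ t) (γ t + s * σ t) ⊆ Ici 0 := by
          intro x hx
          exact (le_min (hγ0 t).le (hpos t)).trans hx.1.le
        rw [h1, Measure.restrict_apply measurableSet_uIoc, inter_eq_left.2 h2, Real.volume_uIoc]
        rw [add_sub_cancel_left, abs_mul, abs_of_pos hs]
      simp_rw [this]
      rw [← ofReal_integral_eq_lintegral_ofReal (hint.const_mul s)
        (Eventually.of_forall fun t => by positivity), integral_const_mul]
    have hnorm : eLpNorm (fun p => F (fun t => γ t + s * σ t) p - F γ p) 2 ν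
        = eLpNorm (A.indicator fun _ => (1:ℝ)) 2 ν := by
      apply eLpNorm_congr_norm_ae
      refine Eventually.of_forall fun p => ?_
      by_cases hp : p ∈ A
      · rw [indicator_of_mem hp]
        have hp' : p.2 ∈ uIoc (γ p.1) (γ p.1 + s * σ p.1) := hp
        rw [mem_uIoc] at hp'
        rcases hp' with h | h
        · simp [F, h.1.not_ge, h.2]
        · simp [F, h.1.not_ge, h.2]
      · rw [indicator_of_notMem hp]
        have hp' : ¬ p.2 ∈ uIoc (γ p.1) (γ p.1 + s * σ p.1) := hp
        rw [mem_uIoc] at hp'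
        push Not at hp'
        by_cases h : p.2 ≤ γ p.1 <;> by_cases h' : p.2 ≤ γ p.1 + s * σ p.1 <;> simp [F, h, h']
        · exact absurd (hp'.2 (not_le.1 h')) h.not_gt
        · exact absurd (hp'.1 (not_le.1 h)) h'.not_gt
    rw [hnorm, eLpNorm_indicator_const hA (by norm_num) (by norm_num), hνA]
    rw [enorm_one, one_mul, ← ENNReal.toReal_rpow, ENNReal.toReal_ofReal (by positivity)]
    rw [ENNReal.toReal_ofNat, ← Real.sqrt_eq_rpow, Real.sqrt_mul hs.le]
    have h0 : √s ≠ 0 := (Real.sqrt_pos.2 hs).ne'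
    have h1 : s = √s * √s := (Real.mul_self_sqrt hs.le).symm
    nth_rewrite 1 [h1]
    field_simp
  have hlim : Tendsto (fun s : ℝ => √k * (√s)⁻¹) (𝓝[>] 0) atTop := by
    refine Tendsto.const_mul_atTop (Real.sqrt_pos.2 hk) (tendsto_inv_nhdsGT_zero.comp ?_)
    refine tendsto_nhdsWithin_iff.2 ⟨?_, ?_⟩
    · have := (Real.continuous_sqrt.tendsto 0).mono_left (nhdsWithin_le_nhds (s := Ioi 0))
      simpa using this
    · filter_upwards [self_mem_nhdsWithin] with s hs using Real.sqrt_pos.2 hs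
  refine hlim.congr' ?_
  filter_upwards [Ioo_mem_nhdsGT hδ] with s hs using (key s hs).symm
end
end

section
/- Let 0 < δ with δ² < π, and let u = F(1) be the image under F of the constant function 1. Then ‖u^δ − u‖_{L²(S¹×[0,∞))} = δ. -/
open MeasureTheory Real Set Filter Topology

noncomputable section

/-- The noisy data `u^δ`: equals `1` for `x < 1 - δ²/π`, `1/2` for `|x - 1| ≤ δ²/π`,
and `0` for `x > 1 + δ²/π`. -/
def uδ (δ : ℝ) : S1 × ℝ → ℝ := fun p =>
  if p.2 < 1 - δ ^ 2 / π then 1 else if p.2 ≤ 1 + δ ^ 2 / π then 1 / 2 else 0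

/-- `‖u^δ - F(1)‖_{L²} = δ`. -/
theorem dist_uδ_eq_delta (δ : ℝ) (hδ : 0 < δ) (hδπ : δ ^ 2 < π) :
    eLpNorm (fun p => uδ δ p - F (fun _ => 1) p) 2 ν = ENNReal.ofReal δ := by
  have hπ : 0 < π := Real.pi_pos
  have ha : 0 < δ ^ 2 / π := by positivity
  have ha1 : δ ^ 2 / π < 1 := (div_lt_one hπ).2 hδπ
  have hms : MeasurableSet
      ((univ : Set S1) ×ˢ Icc (1 - δ ^ 2 / π) (1 + δ ^ 2 / π)) :=
    MeasurableSet.univ.prod measurableSet_Icc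
  have h1 : eLpNorm (fun p => uδ δ p - F (fun _ => 1) p) 2 ν =
      eLpNorm (((univ : Set S1) ×ˢ Icc (1 - δ ^ 2 / π) (1 + δ ^ 2 / π)).indicator
        (fun _ => (1 / 2 : ℝ))) 2 ν := by
    apply eLpNorm_congr_norm_ae
    refine Eventually.of_forall ?_
    rintro ⟨t, x⟩
    simp only [uδ, F, indicator, mem_prod, mem_univ, true_and, mem_Icc]
    split_ifs <;> first | (exfalso; grind) | norm_num
  have h2 : ν ((univ : Set S1) ×ˢ Icc (1 - δ ^ 2 / π) (1 + δ ^ 2 / π)) =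
      ENNReal.ofReal (4 * δ ^ 2) := by
    have hsub : Icc (1 - δ ^ 2 / π) (1 + δ ^ 2 / π) ∩ Ici (0:ℝ) =
        Icc (1 - δ ^ 2 / π) (1 + δ ^ 2 / π) := by
      apply inter_eq_left.2
      intro x hx
      simp only [mem_Icc, mem_Ici] at *
      linarith
    rw [Measure.prod_prod, Measure.restrict_apply measurableSet_Icc, hsub, Real.volume_Icc,
      AddCircle.measure_univ, ← ENNReal.ofReal_mul (by positivity)]
    congr 1
    field_simp
    ring
  rw [h1, eLpNorm_indicator_const hms (by norm_num) (by norm_num), h2,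
    ENNReal.ofReal_rpow_of_nonneg (by positivity) (by norm_num),
    Real.enorm_eq_ofReal (by norm_num), ← ENNReal.ofReal_mul (by norm_num)]
  congr 1
  have h3 : (4 * δ ^ 2 : ℝ) ^ (1 / (2 : ENNReal).toReal) = 2 * δ := by
    rw [ENNReal.toReal_ofNat, ← Real.sqrt_eq_rpow,
      show 4 * δ ^ 2 = (2 * δ) ^ 2 by ring, Real.sqrt_sq (by positivity)]
  rw [h3]
  ring
end
end

section
/- Let 0 < δ with δ² < π and let γ : S¹ → ℝ be measurable and nonnegative. With J⁺ = {t ∈ S¹ : γ(t) > 1 + δ²/π} and J⁻ = {t ∈ S¹ : γ(t) < 1 − δ²/π}, one has ‖F(γ) − u^δ‖²_{L²(S¹×[0,∞))} = δ² + ∫_{J⁺} (γ(t) − 1 − δ²/π) dμ(t) + ∫_{J⁻} (1 − γ(t) − δ²/π) dμ(t). -/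
open MeasureTheory Real Set Filter Topology

noncomputable section

theorem aux_point (δ : ℝ) (hδ : 0 < δ) (γ : S1 → ℝ) (t : S1) (x : ℝ) :
    ‖F γ (t, x) - uδ δ (t, x)‖ₑ ^ (2:ℝ)
      = (Icc (1 - δ ^ 2 / π) (1 + δ ^ 2 / π)).indicator (fun _ => ENNReal.ofReal (1/4)) x
        + (Ioc (1 + δ ^ 2 / π) (γ t)).indicator (fun _ => 1) x
        + (Ioo (γ t) (1 - δ ^ 2 / π)).indicator (fun _ => 1) x := by
  have ha : 0 < δ ^ 2 / π := by positivity
  have h4 : ‖(1/2:ℝ)‖ₑ ^ (2:ℝ) = ENNReal.ofReal (1/4) := by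
    rw [Real.enorm_eq_ofReal (by norm_num), ENNReal.ofReal_rpow_of_nonneg (by norm_num) (by norm_num)]
    norm_num
  have h4n : ‖(-(1/2):ℝ)‖ₑ ^ (2:ℝ) = ENNReal.ofReal (1/4) := by
    rw [enorm_neg, h4]
  simp only [F, uδ, indicator_apply, mem_Icc, mem_Ioc, mem_Ioo]
  generalize δ ^ 2 / π = a at *
  rcases lt_or_ge x (1 - a) with h1 | h1
  · have e1 : ¬ (1 - a ≤ x ∧ x ≤ 1 + a) := fun h => by linarith [h.1]
    have e2 : ¬ (1 + a < x ∧ x ≤ γ t) := fun h => by linarith [h.1]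
    rcases le_or_gt x (γ t) with h2 | h2
    · have e3 : ¬ (γ t < x ∧ x < 1 - a) := fun h => by linarith [h.1]
      rw [if_pos h2, if_pos h1, if_neg e1, if_neg e2, if_neg e3]; simp
    · rw [if_neg (not_le.2 h2), if_pos h1, if_neg e1, if_neg e2, if_pos ⟨h2, h1⟩]; simp
  · have e3 : ¬ (γ t < x ∧ x < 1 - a) := fun h => by linarith [h.2]
    rcases le_or_gt x (1 + a) with h3 | h3
    · have e2 : ¬ (1 + a < x ∧ x ≤ γ t) := fun h => by linarith [h.1]
      rw [if_neg (not_lt.2 h1), if_pos h3, if_pos (show 1 - a ≤ x ∧ x ≤ 1 + a from ⟨h1, h3⟩), if_neg e2, if_neg e3, add_zero, add_zero]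
      split_ifs
      · rw [← h4]; norm_num
      · rw [← h4n]; norm_num
    · have e1 : ¬ (1 - a ≤ x ∧ x ≤ 1 + a) := fun h => by linarith [h.2]
      rw [if_neg (not_lt.2 h1), if_neg (not_le.2 h3), if_neg e1, if_neg e3]
      rcases le_or_gt x (γ t) with h2 | h2
      · rw [if_pos h2, if_pos ⟨h3, h2⟩]; simp
      · rw [if_neg (not_le.2 h2), if_neg (fun h => by linarith [h.2])]; simp

theorem aux_restr (s : Set ℝ) (h : s ⊆ Ici 0) (hs : MeasurableSet s) :
    (volume.restrict (Ici (0:ℝ))) s = volume s := by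
  rw [Measure.restrict_apply hs, inter_eq_left.2 h]

theorem aux_set (f : S1 → ℝ) (s : Set S1) (hs : MeasurableSet s) (h : ∀ t, t ∉ s → f t ≤ 0) :
    ∫⁻ t in s, ENNReal.ofReal (f t) ∂μ = ∫⁻ t, ENNReal.ofReal (f t) ∂μ := by
  rw [← lintegral_indicator hs]
  congr 1
  ext t
  by_cases ht : t ∈ s
  · simp [ht]
  · simp [ht, ENNReal.ofReal_of_nonpos (h t ht)]

/-- Exact expression for the squared `L²` distance `‖F γ - u^δ‖²`. -/
theorem sq_dist_F_uδ (δ : ℝ) (hδ : 0 < δ) (hδπ : δ ^ 2 < π)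
    (γ : S1 → ℝ) (hγ : Measurable γ) (hγ0 : ∀ t, 0 ≤ γ t) :
    eLpNorm (fun p => F γ p - uδ δ p) 2 ν ^ 2
      = ENNReal.ofReal (δ ^ 2)
        + ∫⁻ t in {t | γ t > 1 + δ ^ 2 / π}, ENNReal.ofReal (γ t - 1 - δ ^ 2 / π) ∂μ
        + ∫⁻ t in {t | γ t < 1 - δ ^ 2 / π}, ENNReal.ofReal (1 - γ t - δ ^ 2 / π) ∂μ := by
  have ha : 0 < δ ^ 2 / π := by positivity
  have ha1 : δ ^ 2 / π < 1 := by rw [div_lt_one pi_pos]; exact hδπ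
  have hF : Measurable (F γ) :=
    Measurable.ite (measurableSet_le measurable_snd (hγ.comp measurable_fst))
      measurable_const measurable_const
  have hu : Measurable (uδ δ) :=
    Measurable.ite (measurableSet_lt measurable_snd measurable_const) measurable_const
      (Measurable.ite (measurableSet_le measurable_snd measurable_const)
        measurable_const measurable_const)
  have hm : Measurable (fun p => ‖F γ p - uδ δ p‖ₑ ^ (2:ℝ)) := (hF.sub hu).enorm.pow_const _
  have hn : eLpNorm (fun p => F γ p - uδ δ p) 2 ν ^ 2 = ∫⁻ p, ‖F γ p - uδ δ p‖ₑ ^ (2:ℝ) ∂ν := by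
    rw [eLpNorm_eq_lintegral_rpow_enorm_toReal (by norm_num) (by norm_num), ← ENNReal.rpow_natCast,
      ← ENNReal.rpow_mul]
    norm_num
  rw [hn, lintegral_prod _ hm.aemeasurable]
  have hin : ∀ t, ∫⁻ x, ‖F γ (t, x) - uδ δ (t, x)‖ₑ ^ (2:ℝ) ∂(volume.restrict (Ici (0:ℝ)))
      = ENNReal.ofReal (δ ^ 2 / (2 * π)) + ENNReal.ofReal (γ t - 1 - δ ^ 2 / π)
        + ENNReal.ofReal (1 - γ t - δ ^ 2 / π) := by
    intro t
    simp_rw [aux_point δ hδ γ t]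
    rw [lintegral_add_right _ (measurable_const.indicator measurableSet_Ioo),
      lintegral_add_right _ (measurable_const.indicator measurableSet_Ioc),
      lintegral_indicator_const measurableSet_Icc, lintegral_indicator_const measurableSet_Ioc,
      lintegral_indicator_const measurableSet_Ioo,
      aux_restr _ (fun x hx => by have := hx.1; simp only [mem_Ici]; linarith) measurableSet_Icc,
      aux_restr _ (fun x hx => by have := hx.1; simp only [mem_Ici]; linarith) measurableSet_Ioc,
      aux_restr _ (fun x hx => by have := hx.1; have := hγ0 t; simp only [mem_Ici]; linarith)
        measurableSet_Ioo,
      Real.volume_Icc, Real.volume_Ioc, Real.volume_Ioo, one_mul, one_mul,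
      ← ENNReal.ofReal_mul (by norm_num)]
    have r1 : (1:ℝ) / 4 * (1 + δ ^ 2 / π - (1 - δ ^ 2 / π)) = δ ^ 2 / (2 * π) := by
      field_simp; ring
    have r2 : γ t - (1 + δ ^ 2 / π) = γ t - 1 - δ ^ 2 / π := by ring
    have r3 : 1 - δ ^ 2 / π - γ t = 1 - γ t - δ ^ 2 / π := by ring
    rw [r1, r2, r3]
  simp_rw [hin]
  rw [lintegral_add_right _ (by fun_prop), lintegral_add_right _ (by fun_prop), lintegral_const,
    aux_set _ _ (measurableSet_lt measurable_const hγ)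
      (fun t ht => by simp only [mem_ofPred_eq, not_lt] at ht; linarith),
    aux_set _ _ (measurableSet_lt hγ measurable_const)
      (fun t ht => by simp only [mem_ofPred_eq, not_lt] at ht; linarith),
    AddCircle.measure_univ, ← ENNReal.ofReal_mul (by positivity)]
  congr 3
  field_simp
end
end

section
/- Let 0 < δ with δ² < π. For every continuous nonnegative γ : S¹ → ℝ one has ‖F(γ) − u^δ‖²_{L²(S¹×[0,∞))} ≥ δ², and equality holds if and only if |γ(t) − 1| ≤ δ²/π for every t ∈ S¹. -/
open MeasureTheory Real Set Filter Topology

noncomputable section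

/-- `‖F γ - u^δ‖² ≥ δ²`, with equality iff `|γ t - 1| ≤ δ²/π` for every `t`. -/
theorem sq_dist_F_uδ_ge (δ : ℝ) (hδ : 0 < δ) (hδπ : δ ^ 2 < π)
    (γ : S1 → ℝ) (hγ : Continuous γ) (hγ0 : ∀ t, 0 ≤ γ t) :
    ENNReal.ofReal (δ ^ 2) ≤ eLpNorm (fun p => F γ p - uδ δ p) 2 ν ^ 2
    ∧ (eLpNorm (fun p => F γ p - uδ δ p) 2 ν ^ 2 = ENNReal.ofReal (δ ^ 2)
        ↔ ∀ t, |γ t - 1| ≤ δ ^ 2 / π) := by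
  have hπ := Real.pi_pos
  obtain ⟨a, ha⟩ : ∃ a, a = δ ^ 2 / π := ⟨_, rfl⟩
  have ha0 : 0 < a := by rw [ha]; positivity
  have ha1 : a < 1 := by rw [ha, div_lt_one hπ]; exact hδπ
  have hda : δ ^ 2 = π * a := by rw [ha]; field_simp
  set K : Set (S1 × ℝ) := univ ×ˢ Icc (1 - a) (1 + a) with hK
  set W : Set (S1 × ℝ) := {p | (γ p.1 < p.2 ∧ p.2 < 1 - a) ∨ (1 + a < p.2 ∧ p.2 ≤ γ p.1)} with hW
  have hγ1 : Measurable (fun p : S1 × ℝ => γ p.1) := hγ.measurable.comp measurable_fst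
  have hKm : MeasurableSet K := MeasurableSet.univ.prod measurableSet_Icc
  have hWm : MeasurableSet W := by
    refine MeasurableSet.union (MeasurableSet.inter ?_ ?_) (MeasurableSet.inter ?_ ?_)
    · exact measurableSet_lt hγ1 measurable_snd
    · exact measurableSet_lt measurable_snd measurable_const
    · exact measurableSet_lt measurable_const measurable_snd
    · exact measurableSet_le measurable_snd hγ1
  have hpt : ∀ p : S1 × ℝ, ‖F γ p - uδ δ p‖ₑ ^ 2
      = K.indicator (fun _ => ENNReal.ofReal (1 / 4)) p + W.indicator (fun _ => 1) p := by
    rintro ⟨t, x⟩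
    have key : ‖F γ (t, x) - uδ δ (t, x)‖ₑ ^ 2
        = ENNReal.ofReal ((F γ (t, x) - uδ δ (t, x)) ^ 2) := by
      rw [Real.enorm_eq_ofReal_abs, ← ENNReal.ofReal_pow (abs_nonneg _), sq_abs]
    rw [key]
    simp only [F, uδ, ← ha, Set.indicator, hK, hW, Set.mem_prod, Set.mem_univ, true_and,
      Set.mem_Icc, Set.mem_ofPred_eq]
    rcases lt_or_ge x (1 - a) with h1 | h1
    · have h2 : ¬ (1 + a < x) := by linarith
      have h3 : ¬ (1 - a ≤ x) := by linarith
      by_cases h : x ≤ γ t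
      · simp [h1, h2, h3, h, not_lt.mpr h]
      · simp [h1, h2, h3, h, not_le.mp h]
    · rcases le_or_gt x (1 + a) with h2 | h2
      · by_cases h : x ≤ γ t
        · simp [h1, h2, h, not_lt.mpr h1, not_lt.mpr h2]
          rw [show (1 - 2⁻¹ : ℝ) ^ 2 = 4⁻¹ by norm_num, ENNReal.ofReal_inv_of_pos (by norm_num)]
          norm_num
        · simp [h1, h2, h, not_lt.mpr h1, not_lt.mpr h2]
          norm_num
      · by_cases h : x ≤ γ t
        · simp [h1, h2, h, not_lt.mpr h1, not_le.mpr h2]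
        · simp [h1, h2, h, not_lt.mpr h1, not_le.mpr h2]
  have hνK : ν K = ENNReal.ofReal (2 * π) * ENNReal.ofReal (2 * a) := by
    rw [hK, Measure.prod_prod, AddCircle.measure_univ,
      Measure.restrict_apply measurableSet_Icc, Set.inter_eq_left.mpr, Real.volume_Icc]
    · congr 2; ring
    · intro x hx
      exact le_trans (by linarith) hx.1
  have hmain : eLpNorm (fun p => F γ p - uδ δ p) 2 ν ^ 2 = ENNReal.ofReal (δ ^ 2) + ν W := by
    have h := eLpNorm_nnreal_pow_eq_lintegral (μ := ν) (f := fun p => F γ p - uδ δ p)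
      (p := 2) (by norm_num)
    simp only [NNReal.coe_ofNat, ENNReal.rpow_ofNat, ENNReal.coe_ofNat] at h
    rw [h]
    simp_rw [hpt]
    rw [lintegral_add_left (measurable_const.indicator hKm), lintegral_indicator_const hKm,
      lintegral_indicator_const hWm, one_mul, hνK, ← ENNReal.ofReal_mul (by positivity),
      ← ENNReal.ofReal_mul (by positivity), hda]
    congr 2; ring
  rw [hmain, ← ha]
  refine ⟨le_self_add, ?_⟩
  have hz : ENNReal.ofReal (δ ^ 2) + ν W = ENNReal.ofReal (δ ^ 2) ↔ ν W = 0 := by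
    constructor
    · intro h
      exact (ENNReal.add_right_inj (ENNReal.ofReal_ne_top (r := δ ^ 2))).mp (by rw [h, add_zero])
    · intro h; rw [h, add_zero]
  rw [hz]
  constructor
  · intro h0
    set U : Set (S1 × ℝ) := {p | (γ p.1 < p.2 ∧ p.2 < 1 - a) ∨ (1 + a < p.2 ∧ p.2 < γ p.1)} with hU
    have hγc : Continuous (fun p : S1 × ℝ => γ p.1) := hγ.comp continuous_fst
    have hUo : IsOpen U := by
      refine IsOpen.union (IsOpen.inter ?_ ?_) (IsOpen.inter ?_ ?_)
      · exact isOpen_lt hγc continuous_snd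
      · exact isOpen_lt continuous_snd continuous_const
      · exact isOpen_lt continuous_const continuous_snd
      · exact isOpen_lt continuous_snd hγc
    have hUW : U ⊆ W := by
      rintro p (hp | hp)
      · exact Or.inl hp
      · exact Or.inr ⟨hp.1, hp.2.le⟩
    have hU0 : ν U = 0 := measure_mono_null hUW h0
    have hνe : ν = (μ.prod (volume : Measure ℝ)).restrict (univ ×ˢ Ici 0) := by
      rw [← Measure.prod_restrict, Measure.restrict_univ]
    rw [hνe, Measure.restrict_apply hUo.measurableSet, Set.inter_eq_left.mpr] at hU0
    · have hUe : U = ∅ := (hUo.measure_eq_zero_iff _).mp hU0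
      intro t
      by_contra hc
      rw [not_le, lt_abs] at hc
      rcases hc with hc | hc
      · have : (t, (1 + a + γ t) / 2) ∈ U := Or.inr ⟨by dsimp only; linarith, by dsimp only; linarith⟩
        rw [hUe] at this; exact this
      · have : (t, (1 - a + γ t) / 2) ∈ U := Or.inl ⟨by dsimp only; linarith, by dsimp only; linarith⟩
        rw [hUe] at this; exact this
    · rintro p (hp | hp)
      · exact ⟨trivial, (hγ0 _).trans hp.1.le⟩
      · exact ⟨trivial, le_trans (by linarith) hp.1.le⟩
  · intro h
    have : W = ∅ := by
      ext p
      have := abs_le.mp (h p.1)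
      simp only [hW, Set.mem_ofPred_eq, Set.mem_empty_iff_false, iff_false]
      rintro (hp | hp)
      · linarith [hp.1, hp.2]
      · linarith [hp.1, hp.2]
    rw [this, measure_empty]
end
end

section
/- Let 0 < δ with δ² < π and α > 0. For every γ in the admissible class A one has T_α(γ; u^δ) ≥ δ², and T_α(γ; u^δ) = δ² if and only if γ is a constant function γ ≡ 1 + c for some c with |c| ≤ δ²/π. In particular, for every such c the constant function 1 + c is a minimizer of T_α(·; u^δ) over A, so the Tikhonov functional has infinitely many minimizers for every regularization parameter α > 0. -/
open MeasureTheory Real Set Filter Topology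

noncomputable section

/-- `γ : S¹ → ℝ` is `C¹` with derivative `dγ` if the corresponding `2π`-periodic function
on `ℝ` is everywhere differentiable with derivative the periodic function corresponding
to `dγ`, and `dγ` is continuous. -/
def IsC1 (γ dγ : S1 → ℝ) : Prop :=
  Continuous dγ ∧ ∀ t : ℝ, HasDerivAt (fun x : ℝ => γ (x : S1)) (dγ (t : S1)) t

/-- The Tikhonov functional
`T_α(γ; u) = ‖F γ - u‖²_{L²(S¹×[0,∞))} + α ∫ γ'(t)² dμ(t)`,
where `dγ` denotes the derivative `γ'`. -/
def T (α : ℝ) (γ dγ : S1 → ℝ) (u : S1 × ℝ → ℝ) : ℝ :=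
  (eLpNorm (fun p => F γ p - u p) 2 ν).toReal ^ 2 + α * ∫ t, dγ t ^ 2 ∂μ


lemma IsC1.cont {γ dγ : S1 → ℝ} (h : IsC1 γ dγ) : Continuous γ := by
  have hq : Topology.IsQuotientMap ((↑) : ℝ → S1) := isQuotientMap_quotient_mk'
  rw [hq.continuous_iff]
  exact continuous_iff_continuousAt.2 fun t => (h.2 t).continuousAt

lemma inner_eq (δ s : ℝ) (hδ : 0 < δ) (hδπ : δ ^ 2 < π) (hs : 0 ≤ s) (t : S1) (γ : S1 → ℝ)
    (hγ : γ t = s) :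
    ∫⁻ x in Ici (0:ℝ), ‖F γ (t, x) - uδ δ (t, x)‖ₑ ^ (2:ℝ) =
      ENNReal.ofReal (δ ^ 2 / π / 2 + max (1 - δ ^ 2 / π - s) 0 + max (s - (1 + δ ^ 2 / π)) 0) := by
  have ha : 0 < δ ^ 2 / π := by positivity
  have ha1 : δ ^ 2 / π < 1 := by rw [div_lt_one pi_pos]; exact hδπ
  have key : ∀ x : ℝ, ‖F γ (t, x) - uδ δ (t, x)‖ₑ ^ (2:ℝ) =
      (Icc (1 - δ ^ 2 / π) (1 + δ ^ 2 / π)).indicator (fun _ => ENNReal.ofReal (1/4)) x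
      + (Ioo s (1 - δ ^ 2 / π)).indicator (fun _ => ENNReal.ofReal 1) x
      + (Ioc (1 + δ ^ 2 / π) s).indicator (fun _ => ENNReal.ofReal 1) x := by
    intro x
    rw [Real.enorm_eq_ofReal_abs, ENNReal.ofReal_rpow_of_nonneg (abs_nonneg _) (by norm_num)]
    simp only [F, uδ, hγ, indicator, mem_Icc, mem_Ioo, mem_Ioc]
    generalize δ ^ 2 / π = a at *
    split_ifs <;> first
      | (exfalso; grind)
      | norm_num
  have hsub1 : Icc (1 - δ ^ 2 / π) (1 + δ ^ 2 / π) ∩ Ici 0 = Icc (1 - δ ^ 2 / π) (1 + δ ^ 2 / π) :=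
    inter_eq_left.2 fun x hx => by simp only [mem_Ici]; linarith [hx.1]
  have hsub2 : Ioo s (1 - δ ^ 2 / π) ∩ Ici 0 = Ioo s (1 - δ ^ 2 / π) :=
    inter_eq_left.2 fun x hx => by simp only [mem_Ici]; linarith [hx.1]
  have hsub3 : Ioc (1 + δ ^ 2 / π) s ∩ Ici 0 = Ioc (1 + δ ^ 2 / π) s :=
    inter_eq_left.2 fun x hx => by simp only [mem_Ici]; linarith [hx.1]
  simp_rw [key]
  rw [lintegral_add_right _ (measurable_const.indicator measurableSet_Ioc),
    lintegral_add_right _ (measurable_const.indicator measurableSet_Ioo),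
    lintegral_indicator_const measurableSet_Icc, lintegral_indicator_const measurableSet_Ioo,
    lintegral_indicator_const measurableSet_Ioc, Measure.restrict_apply measurableSet_Icc,
    Measure.restrict_apply measurableSet_Ioo, Measure.restrict_apply measurableSet_Ioc,
    hsub1, hsub2, hsub3, Real.volume_Icc, Real.volume_Ioo, Real.volume_Ioc,
    ENNReal.ofReal_add (by positivity) (by positivity),
    ENNReal.ofReal_add (by positivity) (by positivity), ← ENNReal.ofReal_mul (by norm_num)]
  simp only [ENNReal.ofReal_one, one_mul, ENNReal.ofReal_max, ENNReal.ofReal_zero, zero_le,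
    sup_of_le_left]
  congr 3
  ring

def gg (δ s : ℝ) : ℝ := max (1 - δ ^ 2 / π - s) 0 + max (s - (1 + δ ^ 2 / π)) 0

lemma gg_nonneg (δ s : ℝ) : 0 ≤ gg δ s := by unfold gg; positivity

lemma vol_real : (volume : Measure S1).real univ = 2 * π := by
  rw [Measure.real, AddCircle.measure_univ, ENNReal.toReal_ofReal (by positivity)]

lemma gg_int (δ : ℝ) {γ : S1 → ℝ} (hc : Continuous γ) : Integrable (fun t => gg δ (γ t)) μ := by
  have : Continuous (fun t => gg δ (γ t)) := by unfold gg; fun_prop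
  exact this.integrable_of_hasCompactSupport (HasCompactSupport.of_compactSpace _)

lemma T_eq (δ α : ℝ) (hδ : 0 < δ) (hδπ : δ ^ 2 < π) {γ dγ : S1 → ℝ} (h : IsC1 γ dγ)
    (h0 : ∀ t, 0 ≤ γ t) :
    T α γ dγ (uδ δ) = δ ^ 2 + ∫ t, gg δ (γ t) ∂μ + α * ∫ t, dγ t ^ 2 ∂μ := by
  have hc := h.cont
  have hmF : Measurable (F γ) :=
    Measurable.ite (measurableSet_le measurable_snd (hc.measurable.comp measurable_fst))
      measurable_const measurable_const
  have hmu : Measurable (uδ δ) :=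
    Measurable.ite (measurableSet_lt measurable_snd measurable_const)
      measurable_const (Measurable.ite (measurableSet_le measurable_snd measurable_const)
      measurable_const measurable_const)
  have hm : Measurable (fun p => ‖F γ p - uδ δ p‖ₑ ^ (2:ℝ)) := (hmF.sub hmu).enorm.pow_const _
  have e1 : ∫⁻ p, ‖F γ p - uδ δ p‖ₑ ^ (2:ℝ) ∂ν
      = ENNReal.ofReal (∫ t, (δ ^ 2 / π / 2 + gg δ (γ t)) ∂μ) := by
    rw [lintegral_prod _ hm.aemeasurable, ofReal_integral_eq_lintegral_ofReal]
    · refine lintegral_congr fun t => ?_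
      rw [inner_eq δ (γ t) hδ hδπ (h0 t) t γ rfl, gg, add_assoc]
    · exact (integrable_const _).add (gg_int δ hc)
    · exact Eventually.of_forall fun t => add_nonneg (by positivity) (gg_nonneg _ _)
  have e2 : ∫ t, (δ ^ 2 / π / 2 + gg δ (γ t)) ∂μ = δ ^ 2 + ∫ t, gg δ (γ t) ∂μ := by
    rw [integral_add (integrable_const _) (gg_int δ hc), integral_const, vol_real, smul_eq_mul]
    congr 1
    field_simp
  have hnn : 0 ≤ ∫ t, gg δ (γ t) ∂μ := integral_nonneg fun t => gg_nonneg _ _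
  unfold T
  congr 1
  rw [eLpNorm_eq_lintegral_rpow_enorm_toReal (by norm_num) (by norm_num)]
  simp only [ENNReal.toReal_ofNat]
  rw [e1, e2, ← ENNReal.toReal_rpow, ENNReal.toReal_ofReal (by positivity), ← Real.sqrt_eq_rpow,
    Real.sq_sqrt (by positivity)]

lemma main_const (δ α c : ℝ) (hδ : 0 < δ) (hδπ : δ ^ 2 < π) (hcc : |c| ≤ δ ^ 2 / π)
    {γ dγ : S1 → ℝ} (h : IsC1 γ dγ) (h0 : ∀ t, 0 ≤ γ t) (hγ : ∀ t, γ t = 1 + c) :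
    T α γ dγ (uδ δ) = δ ^ 2 := by
  have hd : ∀ t, dγ t = 0 := by
    intro t
    induction t using QuotientAddGroup.induction_on with
    | H x =>
      have h1 := h.2 x
      simp only [hγ] at h1
      exact h1.unique (hasDerivAt_const x _)
  have hg : ∀ t, gg δ (γ t) = 0 := by
    intro t
    rw [abs_le] at hcc
    rw [hγ, gg, max_eq_right (by linarith), max_eq_right (by linarith), add_zero]
  rw [T_eq δ α hδ hδπ h h0]
  simp [hd, hg]

/-- The Tikhonov functional with data `u^δ` is bounded below by `δ²`, with equality exactly
for the constant functions `1 + c`, `|c| ≤ δ²/π`; in particular every such constant function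
is a minimizer, so there are infinitely many minimizers for every `α > 0`. -/
theorem tikhonov_minimizers (δ α : ℝ) (hδ : 0 < δ) (hδπ : δ ^ 2 < π) (hα : 0 < α) :
    (∀ γ dγ : S1 → ℝ, IsC1 γ dγ → (∀ t, 0 ≤ γ t) → δ ^ 2 ≤ T α γ dγ (uδ δ))
    ∧ (∀ γ dγ : S1 → ℝ, IsC1 γ dγ → (∀ t, 0 ≤ γ t) →
        (T α γ dγ (uδ δ) = δ ^ 2 ↔ ∃ c : ℝ, |c| ≤ δ ^ 2 / π ∧ ∀ t, γ t = 1 + c))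
    ∧ (∀ c : ℝ, |c| ≤ δ ^ 2 / π → ∀ γ dγ : S1 → ℝ, IsC1 γ dγ → (∀ t, 0 ≤ γ t) →
        T α (fun _ => 1 + c) (fun _ => 0) (uδ δ) ≤ T α γ dγ (uδ δ)) := by
  have P1 : ∀ γ dγ : S1 → ℝ, IsC1 γ dγ → (∀ t, 0 ≤ γ t) → δ ^ 2 ≤ T α γ dγ (uδ δ) := by
    intro γ dγ h h0
    rw [T_eq δ α hδ hδπ h h0]
    have h1 : 0 ≤ ∫ t, gg δ (γ t) ∂μ := integral_nonneg fun t => gg_nonneg _ _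
    have h2 : 0 ≤ ∫ t, dγ t ^ 2 ∂μ := integral_nonneg fun t => sq_nonneg _
    have := mul_nonneg hα.le h2
    linarith
  refine ⟨P1, ?_, ?_⟩
  · intro γ dγ h h0
    constructor
    · intro hT
      rw [T_eq δ α hδ hδπ h h0] at hT
      have h1 : 0 ≤ ∫ t, gg δ (γ t) ∂μ := integral_nonneg fun t => gg_nonneg _ _
      have h2 : 0 ≤ ∫ t, dγ t ^ 2 ∂μ := integral_nonneg fun t => sq_nonneg _
      have h3 := mul_nonneg hα.le h2
      have h4 : ∫ t, gg δ (γ t) ∂μ = 0 := by linarith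
      have h5 : ∫ t, dγ t ^ 2 ∂μ = 0 := by
        have : α * ∫ t, dγ t ^ 2 ∂μ = 0 := by linarith
        exact (mul_eq_zero.1 this).resolve_left hα.ne'
      have hcd : Continuous fun t => dγ t ^ 2 := h.1.pow 2
      have h6 : (fun t => dγ t ^ 2) = 0 := by
        rw [integral_eq_zero_iff_of_nonneg (fun t => sq_nonneg _)
          (hcd.integrable_of_hasCompactSupport (HasCompactSupport.of_compactSpace _))] at h5
        exact (hcd.ae_eq_iff_eq μ continuous_const).1 h5
      have h7 : ∀ t, dγ t = 0 := fun t => by simpa using congrFun h6 t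
      have h8 : ∀ t, γ t = γ (((0:ℝ)) : S1) := by
        intro t
        induction t using QuotientAddGroup.induction_on with
        | H x =>
          exact is_const_of_deriv_eq_zero (f := fun x : ℝ => γ (x : S1))
            (fun y => (h.2 y).differentiableAt) (fun y => by rw [(h.2 y).deriv, h7]) x 0
      generalize γ (((0:ℝ)) : S1) = s at h8
      simp only [h8, integral_const, vol_real, smul_eq_mul] at h4
      have h9 : gg δ s = 0 := (mul_eq_zero.1 h4).resolve_left (by positivity)
      refine ⟨s - 1, ?_, fun t => by rw [h8]; ring⟩
      unfold gg at h9
      have a1 := le_max_left (1 - δ ^ 2 / π - s) 0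
      have a2 := le_max_right (1 - δ ^ 2 / π - s) 0
      have a3 := le_max_left (s - (1 + δ ^ 2 / π)) 0
      have a4 := le_max_right (s - (1 + δ ^ 2 / π)) 0
      rw [abs_le]
      constructor <;> linarith
    · rintro ⟨c, hcc, hγ⟩
      exact main_const δ α c hδ hδπ hcc h h0 hγ
  · intro c hcc γ dγ h h0
    rw [main_const δ α c hδ hδπ hcc (γ := fun _ => 1 + c) (dγ := fun _ => 0)
      ⟨continuous_const, fun t => hasDerivAt_const t _⟩ ?_ (fun _ => rfl)]
    · exact P1 γ dγ h h0
    · intro _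
      have ha1 : δ ^ 2 / π < 1 := by rw [div_lt_one pi_pos]; exact hδπ
      have := (abs_le.1 hcc).1
      linarith
end
end

section
/- Weak* directional derivative of F in the space of measures: let γ : S¹ → ℝ be continuous with γ(t) > 0 for all t, let σ : S¹ → ℝ be continuous, and let h : S¹ × [0,∞) → ℝ be bounded and continuous. Then lim_{s → 0⁺} (1/s)·∫_{S¹}∫_0^∞ (F(γ + sσ)(t,x) − F(γ)(t,x))·h(t,x) dx dμ(t) = ∫_{S¹} σ(t)·h(t, γ(t)) dμ(t). -/
open MeasureTheory Real Set Filter Topology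

noncomputable section

lemma inner_ind (f : ℝ → ℝ) (hf : Continuous f) (b : ℝ) (hb : 0 < b) :
    IntegrableOn (fun x => (if x ≤ b then (1:ℝ) else 0) * f x) (Ici 0) ∧
    ∫ x in Ici (0:ℝ), (if x ≤ b then (1:ℝ) else 0) * f x = ∫ x in (0:ℝ)..b, f x := by
  have e : (fun x => (if x ≤ b then (1:ℝ) else 0) * f x) = (Iic b).indicator f := by
    ext x
    by_cases hx : x ≤ b <;> simp [hx, indicator]
  have e2 : Ici (0:ℝ) ∩ Iic b = Icc 0 b := Ici_inter_Iic
  rw [e]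
  constructor
  · rw [IntegrableOn, integrable_indicator_iff measurableSet_Iic, IntegrableOn,
      Measure.restrict_restrict measurableSet_Iic, inter_comm, e2]
    exact hf.continuousOn.integrableOn_Icc
  · rw [setIntegral_indicator measurableSet_Iic, e2, integral_Icc_eq_integral_Ioc,
      intervalIntegral.integral_of_le hb.le]

lemma inner_eq_s16 (f : ℝ → ℝ) (hf : Continuous f) (a b : ℝ) (ha : 0 < a) (hb : 0 < b) :
    ∫ x in Ici (0:ℝ), ((if x ≤ b then (1:ℝ) else 0) - (if x ≤ a then (1:ℝ) else 0)) * f x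
      = (b - a) * ∫ v in (0:ℝ)..1, f (a + (b - a) * v) := by
  simp_rw [sub_mul _ _ (f _)]
  rw [integral_sub (inner_ind f hf b hb).1 (inner_ind f hf a ha).1,
    (inner_ind f hf b hb).2, (inner_ind f hf a ha).2,
    intervalIntegral.integral_interval_sub_left (hf.intervalIntegrable _ _)
      (hf.intervalIntegrable _ _), intervalIntegral.mul_integral_comp_add_mul]
  simp

/-- Weak* directional derivative of `F` in the space of measures: for `γ > 0` continuous,
`σ` continuous and `h` bounded continuous,
`(1/s) ∫∫ (F(γ + sσ) - F(γ)) h → ∫ σ(t) h(t, γ(t)) dμ(t)` as `s → 0⁺`. -/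
theorem weakstar_directional_derivative
    (γ σ : S1 → ℝ) (hγ : Continuous γ) (hσ : Continuous σ) (hγ0 : ∀ t, 0 < γ t)
    (h : S1 × ℝ → ℝ) (hh : Continuous h) (hhb : ∃ M : ℝ, ∀ p, |h p| ≤ M) :
    Tendsto
      (fun s : ℝ => (1 / s) *
        ∫ t, (∫ x in Ici (0:ℝ),
          (F (fun t' => γ t' + s * σ t') (t, x) - F γ (t, x)) * h (t, x)) ∂μ)
      (𝓝[>] 0) (𝓝 (∫ t, σ t * h (t, γ t) ∂μ)) := by

  have hG : Continuous (fun q : ℝ × S1 =>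
      σ q.2 * ∫ v in (0:ℝ)..1, h (q.2, γ q.2 + (q.1 * σ q.2) * v)) := by
    refine (hσ.comp continuous_snd).mul ?_
    apply intervalIntegral.continuous_parametric_intervalIntegral_of_continuous'
    fun_prop
  have hK : Continuous (fun s : ℝ => ∫ t in (univ : Set S1),
      (σ t * ∫ v in (0:ℝ)..1, h (t, γ t + (s * σ t) * v)) ∂μ) :=
    continuous_parametric_integral_of_continuous (by exact hG) isCompact_univ
  have hpos : ∀ᶠ s in 𝓝 (0:ℝ), ∀ t ∈ (univ : Set S1), 0 < γ t + s * σ t := by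
    apply isCompact_univ.eventually_forall_of_forall_eventually
    intro t _
    have hc : Continuous (fun z : ℝ × S1 => γ z.2 + z.1 * σ z.2) := by fun_prop
    exact hc.continuousAt.eventually (lt_mem_nhds (by simpa using hγ0 t))
  have hlim := (hK.tendsto 0).mono_left (nhdsWithin_le_nhds (s := Ioi 0))
  simp only [Measure.restrict_univ, zero_mul, add_zero, intervalIntegral.integral_const, sub_zero,
    one_smul] at hlim
  refine hlim.congr' ?_
  filter_upwards [nhdsWithin_le_nhds hpos, self_mem_nhdsWithin] with s hs hs0
  have hs0' : s ≠ 0 := ne_of_gt hs0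
  rw [← integral_const_mul]
  congr 1
  ext t
  have := inner_eq_s16 (fun x => h (t, x)) (by fun_prop) (γ t) (γ t + s * σ t) (hγ0 t) (hs t trivial)
  simp only [F]
  rw [this, add_sub_cancel_left]
  field_simp
end
end

section
/- One-sided directional derivative of the similarity functional at exact data: let γ : S¹ → ℝ be continuous with γ(t) > 0 for all t, and let σ : S¹ → ℝ be continuous. Define S(η) = ‖F(η) − F(γ)‖²_{L²(S¹×[0,∞))}. Then lim_{s → 0⁺} (1/s)·(S(γ + sσ) − S(γ)) = ∫_{S¹} |σ(t)| dμ(t), i.e. the one-sided directional derivative of S at γ in direction σ equals the L¹ norm of σ. -/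
open MeasureTheory Real Set Filter Topology

noncomputable section

lemma aux_sq (γ σ : S1 → ℝ) (hγ : Continuous γ) (hσ : Continuous σ) (hγ0 : ∀ t, 0 < γ t)
    (s : ℝ) (hs : 0 < s) (h : ∀ t, 0 ≤ γ t + s * σ t) :
    (eLpNorm (fun p => F (fun t => γ t + s * σ t) p - F γ p) 2 ν).toReal ^ 2
      = s * ∫ t, |σ t| ∂μ := by
  set A : Set (S1 × ℝ) := {p | min (γ p.1) (γ p.1 + s * σ p.1) < p.2 ∧
    p.2 ≤ max (γ p.1) (γ p.1 + s * σ p.1)} with hA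
  have hAm : MeasurableSet A := by
    have g := hγ.measurable
    have k := hσ.measurable
    have e1 : Measurable fun p : S1 × ℝ => min (γ p.1) (γ p.1 + s * σ p.1) := by fun_prop
    have e2 : Measurable fun p : S1 × ℝ => max (γ p.1) (γ p.1 + s * σ p.1) := by fun_prop
    exact (measurableSet_lt e1 measurable_snd).inter (measurableSet_le measurable_snd e2)
  have h1 : eLpNorm (fun p => F (fun t => γ t + s * σ t) p - F γ p) 2 ν
      = eLpNorm (A.indicator (fun _ => (1:ℝ))) 2 ν := by
    apply eLpNorm_congr_norm_ae
    refine Eventually.of_forall fun p => ?_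
    by_cases hp : p ∈ A
    · rw [Set.indicator_of_mem hp]
      simp only [hA, mem_ofPred_eq, min_lt_iff, le_max_iff] at hp
      simp only [F]
      split_ifs <;> first | (norm_num; done) | (exfalso; grind)
    · rw [Set.indicator_of_notMem hp]
      simp only [hA, mem_ofPred_eq, min_lt_iff, le_max_iff] at hp
      simp only [F]
      split_ifs <;> first | (norm_num; done) | (exfalso; grind)
  have h2 : ν A = ENNReal.ofReal (s * ∫ t, |σ t| ∂μ) := by
    rw [Measure.prod_apply hAm, ← integral_const_mul, ofReal_integral_eq_lintegral_ofReal]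
    · apply lintegral_congr
      intro t
      have : Prod.mk t ⁻¹' A = Ioc (min (γ t) (γ t + s * σ t)) (max (γ t) (γ t + s * σ t)) := by
        ext x; simp [hA]
      rw [this, Measure.restrict_apply measurableSet_Ioc, inter_eq_left.mpr, Real.volume_Ioc,
        max_sub_min_eq_abs]
      · congr 1
        rw [add_sub_cancel_left, abs_mul, abs_of_pos hs]
      · intro x hx
        exact (le_min (hγ0 t).le (h t)).trans hx.1.le
    · exact ((continuous_const.mul hσ.abs).integrable_of_hasCompactSupport
        (HasCompactSupport.of_compactSpace _))
    · exact Eventually.of_forall fun t => by positivity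
  have h0 : 0 ≤ s * ∫ t, |σ t| ∂μ := mul_nonneg hs.le (integral_nonneg fun t => abs_nonneg _)
  rw [h1, eLpNorm_indicator_const hAm (by norm_num) (by norm_num), h2, enorm_one, one_mul,
    ← ENNReal.toReal_rpow, ENNReal.toReal_ofReal h0, ← Real.rpow_natCast, ← Real.rpow_mul h0]
  norm_num

/-- One-sided directional derivative of the similarity functional at exact data:
for `S(η) = ‖F η - F γ‖²_{L²}`, one has
`(1/s)(S(γ + sσ) - S(γ)) → ∫ |σ| dμ` as `s → 0⁺`. -/
theorem similarity_one_sided_derivative_exact_data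
    (γ σ : S1 → ℝ) (hγ : Continuous γ) (hσ : Continuous σ) (hγ0 : ∀ t, 0 < γ t) :
    Tendsto
      (fun s : ℝ => (1 / s) *
        ((eLpNorm (fun p => F (fun t => γ t + s * σ t) p - F γ p) 2 ν).toReal ^ 2
          - (eLpNorm (fun p => F γ p - F γ p) 2 ν).toReal ^ 2))
      (𝓝[>] 0) (𝓝 (∫ t, |σ t| ∂μ)) := by
  obtain ⟨t₀, -, ht₀⟩ := isCompact_univ.exists_isMinOn univ_nonempty hγ.continuousOn
  obtain ⟨t₁, -, ht₁⟩ := isCompact_univ.exists_isMaxOn univ_nonempty hσ.abs.continuousOn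
  have hd : 0 < |σ t₁| + 1 := by positivity
  have hc : 0 < γ t₀ / (|σ t₁| + 1) := div_pos (hγ0 _) hd
  refine tendsto_const_nhds.congr' ?_
  filter_upwards [Ioo_mem_nhdsGT hc] with s hs
  have hpos : 0 < s := hs.1
  rw [aux_sq γ σ hγ hσ hγ0 s hpos]
  · simp
    field_simp
  · intro t
    have a1 : γ t₀ ≤ γ t := ht₀ (mem_univ t)
    have a2 : |σ t| ≤ |σ t₁| := ht₁ (mem_univ t)
    have a3 := (lt_div_iff₀ hd).1 hs.2
    have a4 := neg_abs_le (σ t)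
    nlinarith
end
end
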